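/- Let q be an odd prime and a ∈ F_q with a ≠ 0. Let I be a set of positive integers with |I| ≤ q, and let (X_i)_{i∈I} be independent random variables each uniform on {−1, +1}. Set Y = ∑_{i∈I} X_i a^i ∈ F_q. Then for every x ∈ F_q, P[Y = x] ≤ 129 |I|^{−1/2}. -/

import Mathlib

open Finset

lemma cb_aux (m : ℕ) : (Nat.centralBinom m)^2 * (2*m+1) ≤ 16^m := by
  induction m with
  | zero => simp
  | succ n ih =>
    have h := Nat.succ_mul_centralBinom_succ n
    have hp : 0 < (n+1)^2 := by positivity
    refine Nat.le_of_mul_le_mul_left ?_ hp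
    calc (n+1)^2 * ((n+1).centralBinom^2 * (2*(n+1)+1))
        = ((n+1) * (n+1).centralBinom)^2 * (2*n+3) := by ring
      _ = (2*(2*n+1)*n.centralBinom)^2 * (2*n+3) := by rw [h]
      _ = (n.centralBinom^2*(2*n+1)) * (4*(2*n+1)*(2*n+3)) := by ring
      _ ≤ 16^n * (4*(2*n+1)*(2*n+3)) := Nat.mul_le_mul_right _ ih
      _ ≤ 16^n * (16 * (n+1)^2) := Nat.mul_le_mul_left _ (by nlinarith)
      _ = (n+1)^2 * 16^(n+1) := by ring

lemma cb_real (m n : ℕ) (hn : n ≤ 2*m+1) :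
    (Nat.centralBinom m : ℝ) * Real.sqrt n ≤ 4^m := by
  have h : ((Nat.centralBinom m : ℝ))^2 * (2*m+1) ≤ 16^m := by exact_mod_cast cb_aux m
  have hn' : (n:ℝ) ≤ 2*m+1 := by exact_mod_cast hn
  refine le_of_sq_le_sq ?_ (by positivity)
  rw [mul_pow, Real.sq_sqrt (by positivity), ← pow_mul, mul_comm m 2, pow_mul]
  norm_num
  refine le_trans ?_ h
  gcongr

section
variable (q : ℕ) [Fact q.Prime]

noncomputable def rr (t : ZMod q) : ℝ := 2 * (ZMod.stdAddChar t).re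

lemma rr_eq (t : ZMod q) : ((rr q t : ℝ) : ℂ) = ZMod.stdAddChar t + ZMod.stdAddChar (-t) := by
  rw [AddChar.map_neg_eq_conj, Complex.add_conj]
  simp [rr]

lemma rr_le (t : ZMod q) : |rr q t| ≤ 2 := by
  have h := Complex.abs_re_le_norm (ZMod.stdAddChar t)
  rw [AddChar.norm_apply] at h
  rw [rr, abs_mul]
  norm_num
  linarith

lemma addChar_sum {ι : Type*} (s : Finset ι) (f : ι → ZMod q) :
    (ZMod.stdAddChar (∑ i ∈ s, f i) : ℂ) = ∏ i ∈ s, ZMod.stdAddChar (f i) := by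
  classical
  induction s using Finset.induction_on with
  | empty => simp
  | insert i s hi ih => rw [Finset.sum_insert hi, Finset.prod_insert hi, AddChar.map_add_eq_mul, ih]

lemma sum_pow_eq (m : ℕ) (hm : 2*m < q) :
    ∑ k : ZMod q, (rr q k)^(2*m) = q * Nat.centralBinom m := by
  have hq : q.Prime := Fact.out
  have : ((∑ k : ZMod q, (rr q k)^(2*m) : ℝ) : ℂ) = ((q * Nat.centralBinom m : ℝ) : ℂ) := by
    push_cast
    have h1 : ∀ k : ZMod q, ((rr q k : ℝ) : ℂ)^(2*m) =
        ∑ j ∈ range (2*m+1), ZMod.stdAddChar (k * (((2*j : ℤ) - (2*m : ℤ) : ℤ) : ZMod q)) * ((2*m).choose j : ℂ) := by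
      intro k
      rw [rr_eq, add_pow]
      refine Finset.sum_congr rfl fun j hj => ?_
      have hj' : j ≤ 2*m := by simp at hj; omega
      rw [← AddChar.map_nsmul_eq_pow, ← AddChar.map_nsmul_eq_pow, ← AddChar.map_add_eq_mul]
      congr 2
      simp only [nsmul_eq_mul]
      rw [Nat.cast_sub hj']
      push_cast
      ring
    simp_rw [h1]
    rw [Finset.sum_comm]
    simp_rw [← Finset.sum_mul]
    rw [Finset.sum_eq_single m]
    · simp [Nat.centralBinom, ZMod.card]
    · intro j hj hjm
      rw [AddChar.sum_mulShift _ (ZMod.isPrimitive_stdAddChar q), if_neg]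
      · simp
      · rw [ZMod.intCast_zmod_eq_zero_iff_dvd]
        intro hd
        simp at hj
        have := Int.eq_zero_of_abs_lt_dvd hd (by rw [abs_lt]; constructor <;> omega)
        omega
    · intro h; simp at h; omega
  exact_mod_cast this

lemma amgm {ι : Type*} (J : Finset ι) (u : ι → ℝ) (hJ : J.Nonempty) :
    ∏ i ∈ J, |u i| ≤ (∑ i ∈ J, |u i|^J.card) / J.card := by
  have hc : J.card ≠ 0 := hJ.card_pos.ne'
  have h := Real.geom_mean_le_arith_mean_weighted J (fun _ => (J.card : ℝ)⁻¹)
    (fun i => |u i|^J.card) (fun _ _ => by positivity)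
    (by simp [hc]) (fun _ _ => by positivity)
  rw [← Finset.mul_sum] at h
  rw [div_eq_inv_mul]
  refine le_trans (le_of_eq (Finset.prod_congr rfl fun i _ => ?_)) h
  exact (Real.pow_rpow_inv_natCast (abs_nonneg _) hc).symm

lemma sum_prod_le {ι : Type*} (J : Finset ι) (b : ι → ZMod q) (hb : ∀ i ∈ J, b i ≠ 0)
    (m : ℕ) (hJ : J.card = 2*m) (hm : 2*m < q) :
    ∑ k : ZMod q, ∏ i ∈ J, |rr q (k * b i)| ≤ q * Nat.centralBinom m := by
  rcases J.eq_empty_or_nonempty with rfl | hne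
  · have : m = 0 := by simp at hJ; omega
    subst this
    simp [ZMod.card]
  · have hc : (0:ℝ) < J.card := by exact_mod_cast hne.card_pos
    calc ∑ k : ZMod q, ∏ i ∈ J, |rr q (k * b i)|
        ≤ ∑ k : ZMod q, (∑ i ∈ J, |rr q (k * b i)|^J.card) / J.card :=
          Finset.sum_le_sum fun k _ => amgm J _ hne
      _ = (∑ i ∈ J, ∑ k : ZMod q, (rr q (k * b i))^(2*m)) / J.card := by
          rw [← Finset.sum_div, Finset.sum_comm, hJ]
          simp_rw [(even_two_mul m).pow_abs]
      _ = (∑ i ∈ J, (q * Nat.centralBinom m : ℝ)) / J.card := by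
          congr 1
          refine Finset.sum_congr rfl fun i hi => ?_
          rw [← sum_pow_eq q m hm]
          exact Equiv.sum_comp (Equiv.mulRight₀ (b i) (hb i hi)) (fun k => (rr q k)^(2*m))
      _ = q * Nat.centralBinom m := by
          rw [Finset.sum_const, nsmul_eq_mul]; field_simp

lemma count_le {ι : Type*} [Fintype ι] [DecidableEq ι] (b : ι → ZMod q) (x : ZMod q) :
    (q : ℝ) * ((Finset.univ.filter (fun ε : ι → Bool =>
        ∑ i, (if ε i then (1 : ZMod q) else -1) * b i = x)).card : ℝ)
      ≤ ∑ k : ZMod q, ∏ i, |rr q (k * b i)| := by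
  have key : ((q : ℂ) * ((Finset.univ.filter (fun ε : ι → Bool =>
        ∑ i, (if ε i then (1 : ZMod q) else -1) * b i = x)).card : ℂ))
      = ∑ k : ZMod q, ZMod.stdAddChar (-(k * x)) * ∏ i, ((rr q (k * b i) : ℝ) : ℂ) := by
    have h1 : ∀ k : ZMod q, ZMod.stdAddChar (-(k * x)) * ∏ i, ((rr q (k * b i) : ℝ) : ℂ)
        = ∑ ε : ι → Bool, ZMod.stdAddChar
          (k * (∑ i, (if ε i then (1 : ZMod q) else -1) * b i - x)) := by
      intro k
      have h2 : ∀ i, ((rr q (k * b i) : ℝ) : ℂ) =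
          ∑ e : Bool, ZMod.stdAddChar (k * ((if e then (1 : ZMod q) else -1) * b i)) := by
        intro i
        rw [rr_eq]; simp
      simp_rw [h2]
      rw [Finset.prod_univ_sum, Fintype.piFinset_univ, Finset.mul_sum]
      refine Finset.sum_congr rfl fun ε _ => ?_
      rw [mul_sub, sub_eq_neg_add, AddChar.map_add_eq_mul, Finset.mul_sum,
        addChar_sum]
    simp_rw [h1]
    rw [Finset.sum_comm]
    simp_rw [AddChar.sum_mulShift _ (ZMod.isPrimitive_stdAddChar q), sub_eq_zero]
    rw [Finset.card_filter]
    push_cast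
    rw [Finset.mul_sum]
    refine Finset.sum_congr rfl fun ε _ => ?_
    split_ifs <;> simp [ZMod.card]
  have h := congrArg norm key
  rw [norm_mul, Complex.norm_natCast, Complex.norm_natCast] at h
  rw [h]
  refine (norm_sum_le _ _).trans (Finset.sum_le_sum fun k _ => ?_)
  rw [norm_mul, AddChar.norm_apply, one_mul, norm_prod]
  simp

end

/-- Littlewood–Offord type bound in `𝔽_q`. Let `q` be an odd prime and
`a ∈ 𝔽_q`, `a ≠ 0`. Let `I` be a (nonempty) set of positive integers with `|I| ≤ q`, and
let `(X_i)_{i ∈ I}` be independent uniform `±1` random variables, modelled by the uniform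
choice of a sign pattern `ε : I → Bool`. Then for every `x ∈ 𝔽_q`, the probability that
`Y = ∑_{i ∈ I} X_i a^i` equals `x` is at most `129 |I|^{-1/2}`. -/
theorem stmt6 (q : ℕ) (hq : q.Prime) (hq2 : q ≠ 2) (a : ZMod q) (ha : a ≠ 0)
    (I : Finset ℕ) (hpos : ∀ i ∈ I, 0 < i) (hne : I.Nonempty) (hcard : I.card ≤ q)
    (x : ZMod q) :
    ((Finset.univ.filter (fun ε : {i // i ∈ I} → Bool =>
        ∑ i ∈ I.attach, (if ε i then (1 : ZMod q) else -1) * a ^ (i : ℕ) = x)).card : ℝ)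
      / 2 ^ I.card ≤ 129 / Real.sqrt I.card := by
  haveI : Fact q.Prime := ⟨hq⟩
  have hc := count_le q (fun i : {i // i ∈ I} => a ^ (i : ℕ)) x
  rw [Finset.univ_eq_attach] at hc
  set N : ℝ := ((Finset.univ.filter (fun ε : {i // i ∈ I} → Bool =>
        ∑ i ∈ I.attach, (if ε i then (1 : ZMod q) else -1) * a ^ (i : ℕ) = x)).card : ℝ) with hN
  have hq0 : (0:ℝ) < q := by exact_mod_cast hq.pos
  have hcp : 0 < I.card := hne.card_pos
  have hs : 0 < Real.sqrt I.card := Real.sqrt_pos.2 (by exact_mod_cast hcp)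
  have hodd : q % 2 = 1 := by
    rcases hq.eq_two_or_odd with h | h
    · exact absurd h hq2
    · exact h
  have hb : ∀ i : {i // i ∈ I}, a ^ (i : ℕ) ≠ 0 := fun i => pow_ne_zero _ ha
  suffices h : N * Real.sqrt I.card ≤ 2 ^ I.card by
    rw [div_le_div_iff₀ (by positivity) hs]
    have : (0:ℝ) < 2 ^ I.card := by positivity
    linarith
  rcases Nat.even_or_odd' I.card with ⟨m, hm | hm⟩
  · have h1 := sum_prod_le q I.attach (fun i => a ^ (i : ℕ)) (fun i _ => hb i) m
      (by simpa using hm) (by omega)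
    have h2 : N ≤ Nat.centralBinom m := le_of_mul_le_mul_left (hc.trans h1) hq0
    calc N * Real.sqrt I.card ≤ Nat.centralBinom m * Real.sqrt I.card := by gcongr
      _ ≤ 4^m := cb_real m _ (by omega)
      _ = 2 ^ I.card := by rw [hm, pow_mul]; norm_num
  · obtain ⟨i0, hi0⟩ := hne
    let j0 : {i // i ∈ I} := ⟨i0, hi0⟩
    have hj0 : j0 ∈ I.attach := by simp
    have h1 := sum_prod_le q (I.attach.erase j0) (fun i => a ^ (i : ℕ)) (fun i _ => hb i) m
      (by rw [Finset.card_erase_of_mem hj0]; simp [hm]) (by omega)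
    have h3 : ∑ k : ZMod q, ∏ i ∈ I.attach, |rr q (k * a ^ (i : ℕ))| ≤
        2 * ∑ k : ZMod q, ∏ i ∈ I.attach.erase j0, |rr q (k * a ^ (i : ℕ))| := by
      rw [Finset.mul_sum]
      refine Finset.sum_le_sum fun k _ => ?_
      rw [← Finset.mul_prod_erase _ _ hj0]
      exact mul_le_mul_of_nonneg_right (rr_le q _) (Finset.prod_nonneg fun _ _ => abs_nonneg _)
    have h2 : N ≤ 2 * Nat.centralBinom m := by
      refine le_of_mul_le_mul_left ?_ hq0
      linarith
    calc N * Real.sqrt I.card ≤ 2 * Nat.centralBinom m * Real.sqrt I.card := by gcongr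
      _ = 2 * (Nat.centralBinom m * Real.sqrt I.card) := by ring
      _ ≤ 2 * 4^m := by
        have := cb_real m I.card (by omega)
        linarith
      _ = 2 ^ I.card := by rw [hm, pow_succ, pow_mul]; norm_num; ring
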